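/- Let T₁, T₂ be geometric actions of a finitely generated group G on ℝ-trees. Then there is a set D ⊂ T₁ × T₂ which is a finite union of compact rectangles K₁ × K₂ (Kᵢ a compact arc of Tᵢ) such that the core C(T₁ × T₂) is contained in the closure of G·D. -/

import Mathlib

/-!
Formalization of definitions from V. Guirardel,
"Core and intersection number for group actions on trees".
-/

open Set Metric Filter Function Topology
open scoped ENNReal Pointwise

noncomputable section

namespace Guirardel

/-- The metric segment `[x,y]`: the set of points lying metrically between `x` and `y`.
In an `ℝ`-tree this is the image of the geodesic from `x` to `y`. -/
def seg {T : Type*} [MetricSpace T] (x y : T) : Set T :=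
  {p : T | dist x p + dist p y = dist x y}

/-- The open segment `]x,y[`. -/
def openSeg {T : Type*} [MetricSpace T] (x y : T) : Set T :=
  seg x y \ {x, y}

/-- A subset of an `ℝ`-tree is convex (i.e. a subtree when nonempty) if it contains the
segment between any two of its points. -/
def TreeConvex {T : Type*} [MetricSpace T] (S : Set T) : Prop :=
  ∀ x ∈ S, ∀ y ∈ S, seg x y ⊆ S

/-- An `ℝ`-tree: any two points are joined by a geodesic, and any two injective paths
with the same endpoints have the same image (uniqueness of arcs). -/
structure IsRTree (T : Type*) [MetricSpace T] : Prop where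
  exists_geod : ∀ x y : T, ∃ f : ℝ → T, f 0 = x ∧ f (dist x y) = y ∧
    ∀ s ∈ Icc (0 : ℝ) (dist x y), ∀ t ∈ Icc (0 : ℝ) (dist x y),
      dist (f s) (f t) = |s - t|
  arc_unique : ∀ (x y : T) (γ₁ γ₂ : Path x y),
    Function.Injective γ₁ → Function.Injective γ₂ →
      Set.range γ₁ = Set.range γ₂

/-- A direction based at `x`: a connected component of the complement of `x`. -/
def IsDirectionAt {T : Type*} [MetricSpace T] (δ : Set T) (x : T) : Prop :=
  ∃ y : T, y ≠ x ∧ δ = connectedComponentIn {x}ᶜ y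

/-- A direction in a tree. -/
def IsDirection {T : Type*} [MetricSpace T] (δ : Set T) : Prop :=
  ∃ x : T, IsDirectionAt δ x

/-- A branch point: a point with at least three directions. -/
def IsBranchPoint {T : Type*} [MetricSpace T] (x : T) : Prop :=
  ∃ δ₁ δ₂ δ₃ : Set T, IsDirectionAt δ₁ x ∧ IsDirectionAt δ₂ x ∧ IsDirectionAt δ₃ x ∧
    δ₁ ≠ δ₂ ∧ δ₁ ≠ δ₃ ∧ δ₂ ≠ δ₃

/-- A quadrant in `T₁ × T₂`: a product of two directions. -/
def IsQuadrant {T₁ T₂ : Type*} [MetricSpace T₁] [MetricSpace T₂]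
    (Q : Set (T₁ × T₂)) : Prop :=
  ∃ (δ₁ : Set T₁) (δ₂ : Set T₂), IsDirection δ₁ ∧ IsDirection δ₂ ∧ Q = δ₁ ×ˢ δ₂

/-- A quadrant is heavy if (for every choice of base point, which does not matter) there
is a sequence of orbit points inside it whose two coordinates go to infinity. -/
def Heavy (G : Type*) {T₁ T₂ : Type*} [Group G] [MetricSpace T₁] [MetricSpace T₂]
    [MulAction G T₁] [MulAction G T₂] (Q : Set (T₁ × T₂)) : Prop :=
  ∀ p : T₁ × T₂, ∃ γ : ℕ → G,
    (∀ k, ((γ k • p.1 : T₁), (γ k • p.2 : T₂)) ∈ Q) ∧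
    Tendsto (fun k => dist (γ k • p.1) p.1) atTop atTop ∧
    Tendsto (fun k => dist (γ k • p.2) p.2) atTop atTop

/-- The core of `T₁ × T₂`: the complement of the union of all light (i.e. non-heavy)
quadrants; equivalently the set of points all of whose quadrants are heavy. -/
def Core (G T₁ T₂ : Type*) [Group G] [MetricSpace T₁] [MetricSpace T₂]
    [MulAction G T₁] [MulAction G T₂] : Set (T₁ × T₂) :=
  {z : T₁ × T₂ | ∀ Q : Set (T₁ × T₂), IsQuadrant Q → z ∈ Q → Heavy G Q}

/-- A subset of `T₁ × T₂` has convex fibers if its horizontal and vertical fibers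
are convex. -/
def ConvexFibers {T₁ T₂ : Type*} [MetricSpace T₁] [MetricSpace T₂]
    (E : Set (T₁ × T₂)) : Prop :=
  (∀ x₁ : T₁, TreeConvex {y₂ : T₂ | (x₁, y₂) ∈ E}) ∧
  (∀ x₂ : T₂, TreeConvex {y₁ : T₁ | (y₁, x₂) ∈ E})

/-- The action of `G` on `T` is by isometries. -/
def IsometricAction (G T : Type*) [MetricSpace T] [SMul G T] : Prop :=
  ∀ (g : G) (x y : T), dist (g • x) (g • y) = dist x y

/-- `g` is elliptic: it fixes a point of `T`. -/
def Elliptic {G : Type*} (T : Type*) [SMul G T] (g : G) : Prop :=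
  ∃ x : T, g • x = x

/-- `g` is hyperbolic: it fixes no point of `T`. -/
def Hyperbolic {G : Type*} (T : Type*) [SMul G T] (g : G) : Prop :=
  ∀ x : T, g • x ≠ x

/-- Translation length of `g` on `T`. -/
def translationLength {G : Type*} (T : Type*) [MetricSpace T] [SMul G T] (g : G) : ℝ :=
  ⨅ x : T, dist x (g • x)

/-- The axis (characteristic set) of `g`: points minimizing displacement. -/
def axisSet {G : Type*} (T : Type*) [MetricSpace T] [SMul G T] (g : G) : Set T :=
  {x : T | ∀ y : T, dist x (g • x) ≤ dist y (g • y)}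

/-- The action is non-trivial: some element is hyperbolic. -/
def NontrivialAction (G T : Type*) [SMul G T] : Prop :=
  ∃ g : G, ∀ x : T, g • x ≠ x

/-- The action is free: only the identity fixes a point. -/
def FreeAction (G T : Type*) [Group G] [MulAction G T] : Prop :=
  ∀ g : G, g ≠ 1 → ∀ x : T, g • x ≠ x

/-- The action is minimal: no proper nonempty invariant subtree. -/
def MinimalAction (G T : Type*) [MetricSpace T] [SMul G T] : Prop :=
  ∀ S : Set T, S.Nonempty → TreeConvex S → (∀ g : G, ∀ x ∈ S, g • x ∈ S) → S = univ

/-- The minimal subtree for the subset `H` of `G`: the intersection of all nonempty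
invariant subtrees. -/
def minSubtreeOf {G : Type*} (H : Set G) (T : Type*) [MetricSpace T] [SMul G T] : Set T :=
  ⋂₀ {S : Set T | S.Nonempty ∧ TreeConvex S ∧ ∀ g ∈ H, ∀ x ∈ S, g • x ∈ S}

/-- The minimal subtree of the `G`-action. -/
def minSubtree (G T : Type*) [MetricSpace T] [SMul G T] : Set T :=
  minSubtreeOf (univ : Set G) T

/-- A line in `T`: the image of an isometric embedding of `ℝ`. -/
def IsLine {T : Type*} [MetricSpace T] (L : Set T) : Prop :=
  ∃ f : ℝ → T, (∀ s t : ℝ, dist (f s) (f t) = |s - t|) ∧ L = range f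

/-- A ray in `T`: the image of an isometric embedding of `[0,∞)`. -/
def IsRay {T : Type*} [MetricSpace T] (R : Set T) : Prop :=
  ∃ f : ℝ → T, (∀ s ∈ Ici (0 : ℝ), ∀ t ∈ Ici (0 : ℝ), dist (f s) (f t) = |s - t|) ∧
    R = f '' Ici 0

/-- Two rays (or subsets) define the same end when they are at finite Hausdorff distance. -/
def SameEnd {T : Type*} [MetricSpace T] (R R' : Set T) : Prop :=
  EMetric.hausdorffEdist R R' ≠ ⊤

/-- The action of `G` fixes an end of `T`. -/
def GFixedEnd (G T : Type*) [MetricSpace T] [SMul G T] : Prop :=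
  ∃ R : Set T, IsRay R ∧ ∀ g : G, SameEnd ((fun x => g • x) '' R) R

/-- The action of `G` has an invariant line. -/
def GInvariantLine (G T : Type*) [MetricSpace T] [SMul G T] : Prop :=
  ∃ L : Set T, IsLine L ∧ ∀ g : G, (fun x => g • x) '' L = L

/-- The action is irreducible: no invariant line and no fixed end. -/
def IrreducibleAction (G T : Type*) [MetricSpace T] [SMul G T] : Prop :=
  ¬ GInvariantLine G T ∧ ¬ GFixedEnd G T

/-- The action is dihedral: there is an invariant line on which some element acts as a
reflection (i.e. with non-constant displacement along the line). -/
def DihedralAction (G T : Type*) [MetricSpace T] [SMul G T] : Prop :=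
  ∃ L : Set T, IsLine L ∧ (∀ g : G, (fun x => g • x) '' L = L) ∧
    ∃ g : G, ∃ x ∈ L, ∃ y ∈ L, dist x (g • x) ≠ dist y (g • y)

/-- `A` is a positive semi-axis of `g`: a ray contained in the axis of `g` and mapped
into itself by `g`. -/
def PosSemiAxis {G : Type*} (T : Type*) [MetricSpace T] [SMul G T] (g : G) (A : Set T) :
    Prop :=
  IsRay A ∧ A ⊆ axisSet T g ∧ (fun x => g • x) '' A ⊆ A

/-- `g` translates towards the end determined by the ray `R`:
`g` is hyperbolic and has a positive semi-axis defining the same end as `R`. -/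
def TranslatesToward {G : Type*} (T : Type*) [MetricSpace T] [SMul G T] (g : G)
    (R : Set T) : Prop :=
  Hyperbolic T g ∧ ∃ A : Set T, PosSemiAxis T g A ∧ SameEnd A R

/-- The end `ω_T(g)` of the hyperbolic element `g` lies in the set of ends of `δ`:
some positive semi-axis of `g` is contained in `δ`. -/
def EndInSubtree {G : Type*} (T : Type*) [MetricSpace T] [SMul G T] (g : G)
    (δ : Set T) : Prop :=
  ∃ A : Set T, PosSemiAxis T g A ∧ A ⊆ δ

/-- A map between `ℝ`-trees preserves alignment if the image of a point between `y`
and `z` lies between the images of `y` and `z`. -/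
def AlignPreserving {T T' : Type*} [MetricSpace T] [MetricSpace T'] (f : T → T') : Prop :=
  ∀ x y z : T, x ∈ seg y z → f x ∈ seg (f y) (f z)

/-- `f : T → T'` witnesses that `T` is a refinement of `T'`: it is an equivariant
continuous surjection preserving alignment. -/
def IsRefinementMap (G : Type*) {T T' : Type*} [Group G] [MetricSpace T] [MetricSpace T']
    [MulAction G T] [MulAction G T'] (f : T → T') : Prop :=
  Continuous f ∧ Surjective f ∧ AlignPreserving f ∧ ∀ (g : G) (x : T), f (g • x) = g • f x

/-- The length functions of the two actions are homothetic. -/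
def HomotheticLengths (G T₁ T₂ : Type*) [MetricSpace T₁] [MetricSpace T₂] [SMul G T₁]
    [SMul G T₂] : Prop :=
  ∃ c : ℝ, 0 < c ∧ ∀ g : G, translationLength T₁ g = c * translationLength T₂ g

/-- A bundled `ℝ`-tree with an isometric action of `G`. -/
structure GTree (G : Type*) [Group G] where
  carrier : Type
  [ms : MetricSpace carrier]
  [ma : MulAction G carrier]
  isom : ∀ (g : G) (x y : carrier), dist (g • x) (g • y) = dist x y
  tree : IsRTree carrier

attribute [instance] GTree.ms GTree.ma

/-- A simplicial structure on an `ℝ`-tree: a vertex set containing all branch points,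
meeting every segment in a finite set, and discrete. -/
def IsSimplicialStructure {T : Type*} [MetricSpace T] (V : Set T) : Prop :=
  (∀ x : T, IsBranchPoint x → x ∈ V) ∧
  (∀ x y : T, (seg x y ∩ V).Finite) ∧
  (∀ v ∈ V, ∃ ε > 0, ∀ w ∈ V, dist v w < ε → w = v)

/-- Two vertices of a simplicial tree are adjacent (span an edge). -/
def Adjacent {T : Type*} [MetricSpace T] (V : Set T) (v w : T) : Prop :=
  v ∈ V ∧ w ∈ V ∧ v ≠ w ∧ seg v w ∩ V = {v, w}

/-- A bundled simplicial `G`-tree. -/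
structure SimplicialGTree (G : Type*) [Group G] extends GTree G where
  V : Set carrier
  simp : IsSimplicialStructure V
  inv : ∀ g : G, (fun x => g • x) '' V = V

/-- `T₁` and `T₂` are refinements of a common non-trivial simplicial action of `G`. -/
def RefineCommonSimplicial (G T₁ T₂ : Type*) [Group G] [MetricSpace T₁] [MetricSpace T₂]
    [MulAction G T₁] [MulAction G T₂] : Prop :=
  ∃ T' : SimplicialGTree G, NontrivialAction G T'.carrier ∧
    (∃ f₁ : T₁ → T'.carrier, IsRefinementMap G f₁) ∧
    (∃ f₂ : T₂ → T'.carrier, IsRefinementMap G f₂)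

/-- Two directions face each other: their union is the whole tree. -/
def FacingDirections {T : Type*} [MetricSpace T] (δ δ' : Set T) : Prop :=
  δ ∪ δ' = univ

/-- There is a twice-light rectangle with (opposite) base corners `x` and `x'`:
two light quadrants based at `x` and `x'` facing each other. -/
def IsTwiceLightRect (G : Type*) {T₁ T₂ : Type*} [Group G] [MetricSpace T₁]
    [MetricSpace T₂] [MulAction G T₁] [MulAction G T₂] (x x' : T₁ × T₂) : Prop :=
  ∃ (δ₁ : Set T₁) (δ₂ : Set T₂) (δ₁' : Set T₁) (δ₂' : Set T₂),
    IsDirectionAt δ₁ x.1 ∧ IsDirectionAt δ₂ x.2 ∧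
    IsDirectionAt δ₁' x'.1 ∧ IsDirectionAt δ₂' x'.2 ∧
    x.1 ≠ x'.1 ∧ x.2 ≠ x'.2 ∧
    FacingDirections δ₁ δ₁' ∧ FacingDirections δ₂ δ₂' ∧
    ¬ Heavy G (δ₁ ×ˢ δ₂) ∧ ¬ Heavy G (δ₁' ×ˢ δ₂')

/-- The open rectangle with opposite corners `x, x'`. -/
def openRect {T₁ T₂ : Type*} [MetricSpace T₁] [MetricSpace T₂] (x x' : T₁ × T₂) :
    Set (T₁ × T₂) :=
  openSeg x.1 x'.1 ×ˢ openSeg x.2 x'.2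

/-- A maximal twice-light rectangle. -/
def IsMaxTwiceLightRect (G : Type*) {T₁ T₂ : Type*} [Group G] [MetricSpace T₁]
    [MetricSpace T₂] [MulAction G T₁] [MulAction G T₂] (x x' : T₁ × T₂) : Prop :=
  IsTwiceLightRect G x x' ∧ ∀ y y' : T₁ × T₂, IsTwiceLightRect G y y' →
    openRect x x' ⊆ openRect y y' → openRect x x' = openRect y y'

/-- The straight diagonal of a rectangle joining the two opposite corners `p` and `q`. -/
def mainDiag {T₁ T₂ : Type*} [MetricSpace T₁] [MetricSpace T₂] (p q : T₁ × T₂) :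
    Set (T₁ × T₂) :=
  {z : T₁ × T₂ | z.1 ∈ seg p.1 q.1 ∧ z.2 ∈ seg p.2 q.2 ∧
    dist p.1 z.1 * dist p.2 q.2 = dist p.2 z.2 * dist p.1 q.1}

/-- The augmented core: the union of the core and of the main diagonals of the maximal
twice-light rectangles (the diagonals joining the two opposite corners lying in the core). -/
def AugCore (G T₁ T₂ : Type*) [Group G] [MetricSpace T₁] [MetricSpace T₂]
    [MulAction G T₁] [MulAction G T₂] : Set (T₁ × T₂) :=
  Core G T₁ T₂ ∪
    {z : T₁ × T₂ | ∃ x x' p q : T₁ × T₂, IsMaxTwiceLightRect G x x' ∧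
      p ∈ Core G T₁ T₂ ∧ q ∈ Core G T₁ T₂ ∧
      ({p.1, q.1} : Set T₁) = {x.1, x'.1} ∧ ({p.2, q.2} : Set T₂) = {x.2, x'.2} ∧
      p.1 ≠ q.1 ∧ p.2 ≠ q.2 ∧ z ∈ mainDiag p q}

/-- There exists an equivariant (strong) deformation retraction of `T₁ × T₂` onto `C`. -/
def EquivDeformRetract (G : Type*) {T₁ T₂ : Type*} [Group G] [MetricSpace T₁]
    [MetricSpace T₂] [MulAction G T₁] [MulAction G T₂] (C : Set (T₁ × T₂)) : Prop :=
  ∃ H : ℝ → T₁ × T₂ → T₁ × T₂,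
    Continuous (fun p : ℝ × (T₁ × T₂) => H p.1 p.2) ∧
    (∀ z : T₁ × T₂, H 0 z = z) ∧
    (∀ z : T₁ × T₂, H 1 z ∈ C) ∧
    (∀ t : ℝ, ∀ z ∈ C, H t z = z) ∧
    (∀ (t : ℝ) (g : G) (z : T₁ × T₂), H t (g • z) = g • H t z)

/-- The `ℓ²` product distance on `T₁ × T₂`. -/
def dist2 {T₁ T₂ : Type*} [MetricSpace T₁] [MetricSpace T₂] (p q : T₁ × T₂) : ℝ :=
  Real.sqrt (dist p.1 q.1 ^ 2 + dist p.2 q.2 ^ 2)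

/-- The length of a path `c : [0,1] → T₁ × T₂`, measured with the `ℓ²` product metric. -/
def pathLen2 {T₁ T₂ : Type*} [MetricSpace T₁] [MetricSpace T₂] (c : ℝ → T₁ × T₂) :
    ℝ≥0∞ :=
  ⨆ (n : ℕ) (u : Fin (n + 1) → ℝ) (_ : Monotone u) (_ : ∀ i, u i ∈ Icc (0 : ℝ) 1),
    ∑ i : Fin n, ENNReal.ofReal (dist2 (c (u i.castSucc)) (c (u i.succ)))

/-- The path metric induced on a subset `C ⊆ T₁ × T₂` by the `ℓ²` product metric. -/
def pathDistOn {T₁ T₂ : Type*} [MetricSpace T₁] [MetricSpace T₂] (C : Set (T₁ × T₂))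
    (x y : C) : ℝ :=
  (⨅ (c : ℝ → T₁ × T₂) (_ : ContinuousOn c (Icc (0 : ℝ) 1))
      (_ : MapsTo c (Icc (0 : ℝ) 1) C) (_ : c 0 = (x : T₁ × T₂))
      (_ : c 1 = (y : T₁ × T₂)), pathLen2 c).toReal

/-- A distance function makes a set a CAT(0) space: it is a metric, geodesic, and the
CN-inequality of Bruhat–Tits holds (comparison triangles are at least as thick). -/
structure IsCAT0Dist {X : Type*} (d : X → X → ℝ) : Prop where
  refl : ∀ x, d x x = 0
  symm : ∀ x y, d x y = d y x
  triangle : ∀ x y z, d x z ≤ d x y + d y z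
  eq_of_dist_eq_zero : ∀ x y, d x y = 0 → x = y
  geodesic : ∀ x y, ∃ f : ℝ → X, f 0 = x ∧ f (d x y) = y ∧
    ∀ s ∈ Icc (0 : ℝ) (d x y), ∀ t ∈ Icc (0 : ℝ) (d x y), d (f s) (f t) = |s - t|
  cn : ∀ x y z m, d y m = d y z / 2 → d m z = d y z / 2 →
    d x m ^ 2 ≤ (d x y ^ 2 + d x z ^ 2) / 2 - d y z ^ 2 / 4

/-- A 2-cell of the core of a product of two simplicial trees: a rectangle which is a
product of two edges and is contained in the core. -/
def IsCoreCell (G : Type*) {T₁ T₂ : Type*} [Group G] [MetricSpace T₁] [MetricSpace T₂]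
    [MulAction G T₁] [MulAction G T₂] (V₁ : Set T₁) (V₂ : Set T₂)
    (R : Set (T₁ × T₂)) : Prop :=
  ∃ v₁ w₁ v₂ w₂, Adjacent V₁ v₁ w₁ ∧ Adjacent V₂ v₂ w₂ ∧
    R = seg v₁ w₁ ×ˢ seg v₂ w₂ ∧ R ⊆ Core G T₁ T₂


/-! ### Geometric actions: measured foliations on 2-complexes -/

attribute [local instance] Classical.decEq

/-- A big ambient vector space in which all the simplicial 2-complexes with cocompact
`G`-action that we need can be realized. -/
abbrev Amb (G : Type*) : Type _ := (G × ℕ) → ℝ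

/-- The transverse pseudo-distance of a measured foliation on a simplicial complex,
where the foliation is given by an affine map `fol s` on each face `s`: the infimum over
chains of points, consecutive ones lying in a common face, of the total transverse
measure. -/
def foliationDist {E : Type*} [AddCommGroup E] [Module ℝ E]
    (K : Geometry.SimplicialComplex ℝ E) (fol : Finset E → E →ᵃ[ℝ] ℝ) (x y : E) :
    ℝ≥0∞ :=
  ⨅ (n : ℕ) (c : Fin (n + 1) → E) (S : Fin n → Finset E)
    (_ : c 0 = x) (_ : c (Fin.last n) = y)
    (_ : ∀ i : Fin n, S i ∈ K.faces ∧
      c i.castSucc ∈ convexHull ℝ (S i : Set E) ∧ c i.succ ∈ convexHull ℝ (S i : Set E)),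
    ∑ i : Fin n, ENNReal.ofReal |fol (S i) (c i.castSucc) - fol (S i) (c i.succ)|

/-- A measured foliation on a simplicial 2-complex with a free, properly discontinuous,
cocompact, simplicial `G`-action, together with an identification of `T` with the leaf
space made Hausdorff (so that `T` is dual to the foliated complex). -/
structure GeometricStructure (G : Type*) [Group G] (T : Type*) [MetricSpace T]
    [MulAction G T] where
  /-- the underlying simplicial complex -/
  K : Geometry.SimplicialComplex ℝ (Amb G)
  nonempty : K.faces.Nonempty
  /-- the complex is 2-dimensional -/
  dim2 : ∀ s ∈ K.faces, s.card ≤ 3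
  /-- the `G`-action on the complex, by continuous affine automorphisms -/
  ρ : G →* Amb G ≃ᵃ[ℝ] Amb G
  contρ : ∀ g : G, Continuous (ρ g)
  mapsFaces : ∀ g : G, ∀ s ∈ K.faces, Finset.image (ρ g) s ∈ K.faces
  /-- the action is free -/
  freeAct : ∀ g : G, g ≠ 1 → ∀ x ∈ K.space, ρ g x ≠ x
  /-- the action is properly discontinuous -/
  pdisc : ∀ C C' : Set (Amb G), IsCompact C → IsCompact C' →
    {g : G | ((ρ g) '' (C ∩ K.space) ∩ C').Nonempty}.Finite
  /-- the action is cocompact: finitely many orbits of faces -/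
  cocompact : ∃ F : Set (Finset (Amb G)), F.Finite ∧ F ⊆ K.faces ∧
    ∀ s ∈ K.faces, ∃ t ∈ F, ∃ g : G, s = Finset.image (ρ g) t
  /-- the measured foliation: an affine map to `ℝ` on each face... -/
  fol : Finset (Amb G) → Amb G →ᵃ[ℝ] ℝ
  /-- ...compatible on faces of faces up to isometries of `ℝ`... -/
  fol_compat : ∀ s ∈ K.faces, ∀ t ∈ K.faces, t ⊆ s →
    ∃ ε c : ℝ, (ε = 1 ∨ ε = -1) ∧
      ∀ x ∈ convexHull ℝ (t : Set (Amb G)), fol t x = ε * fol s x + c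
  /-- ...and `G`-invariant up to isometries of `ℝ` -/
  fol_equivariant : ∀ g : G, ∀ s ∈ K.faces, ∃ ε c : ℝ, (ε = 1 ∨ ε = -1) ∧
    ∀ x ∈ convexHull ℝ (s : Set (Amb G)), fol (Finset.image (ρ g) s) (ρ g x) = ε * fol s x + c
  /-- the equivariant projection identifying `T` with the leaf space made Hausdorff -/
  proj : Amb G → T
  proj_equivariant : ∀ g : G, ∀ x ∈ K.space, proj (ρ g x) = g • proj x
  proj_surjective : ∀ t : T, ∃ x ∈ K.space, proj x = t
  proj_dist : ∀ x ∈ K.space, ∀ y ∈ K.space,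
    ENNReal.ofReal (dist (proj x) (proj y)) = foliationDist K fol x y
  /-- transverse edges embed isometrically in `T` -/
  edges_embed : ∀ s ∈ K.faces, s.card ≤ 2 →
    ∀ x ∈ convexHull ℝ (s : Set (Amb G)), ∀ y ∈ convexHull ℝ (s : Set (Amb G)),
      dist (proj x) (proj y) = |fol s x - fol s y|

/-- An action of a finitely generated group on an `ℝ`-tree is geometric if the tree is
equivariantly dual to a measured foliation on a simplicial 2-complex endowed with a
free, properly discontinuous, cocompact action of `G`. -/
def GeometricAction (G : Type*) [Group G] (T : Type*) [MetricSpace T] [MulAction G T] :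
    Prop :=
  Nonempty (GeometricStructure G T)

/-! ### Segments in `ℝ`-trees -/

section Segments

variable {T : Type*} [MetricSpace T]

lemma mem_seg {x y p : T} : p ∈ seg x y ↔ dist x p + dist p y = dist x y := Iff.rfl

lemma left_mem_seg (x y : T) : x ∈ seg x y := by simp [mem_seg]

lemma right_mem_seg (x y : T) : y ∈ seg x y := by simp [mem_seg]

lemma seg_comm (x y : T) : seg x y = seg y x := by
  ext p
  simp only [mem_seg, dist_comm x, dist_comm _ y]
  rw [add_comm, dist_comm p x, dist_comm y p]

lemma eq_of_mem_seg_self {x p : T} (h : p ∈ seg x x) : p = x := by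
  rw [mem_seg, dist_self, dist_comm p x] at h
  have := dist_nonneg (x := x) (y := p)
  exact (dist_eq_zero.1 (by linarith)).symm

lemma seg_subset_seg_left {x y p : T} (h : p ∈ seg x y) : seg x p ⊆ seg x y := by
  intro q hq
  rw [mem_seg] at *
  linarith [dist_triangle q p y, dist_triangle x q y]

lemma smul_mem_seg {G : Type*} [SMul G T] (hiso : IsometricAction G T) (g : G) {x y p : T}
    (h : p ∈ seg x y) : g • p ∈ seg (g • x) (g • y) := by
  rw [mem_seg] at *
  rw [hiso, hiso, hiso, h]

/-- Two geodesics meeting only at the endpoint of the first and the origin of the second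
concatenate to an arc. -/
lemma exists_injective_path_of_geodesics {f g : ℝ → T} {a b : ℝ} (ha : 0 ≤ a) (hb : 0 ≤ b)
    (hab : 0 < a + b)
    (hf : ∀ s ∈ Icc (0 : ℝ) a, ∀ t ∈ Icc (0 : ℝ) a, dist (f s) (f t) = |s - t|)
    (hg : ∀ s ∈ Icc (0 : ℝ) b, ∀ t ∈ Icc (0 : ℝ) b, dist (g s) (g t) = |s - t|)
    (hfg : f a = g 0)
    (hinj : ∀ s ∈ Icc (0 : ℝ) a, ∀ t ∈ Icc (0 : ℝ) b, f s = g t → s = a) :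
    ∃ γ : Path (f 0) (g b), Function.Injective γ ∧ f a ∈ Set.range γ ∧
      Set.range γ ⊆ f '' Icc 0 a ∪ g '' Icc 0 b := by
  set h : ℝ → T := fun t => if t ≤ a then f t else g (t - a) with hh
  have hlip : ∀ s ∈ Icc (0 : ℝ) (a + b), ∀ t ∈ Icc (0 : ℝ) (a + b), s ≤ t →
      dist (h s) (h t) ≤ t - s ∧ (h s = h t → s = t) := by
    rintro s ⟨hs0, hs1⟩ t ⟨ht0, ht1⟩ hst
    by_cases hta : t ≤ a
    · have hsa := hst.trans hta
      have hd := hf s ⟨hs0, hsa⟩ t ⟨ht0, hta⟩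
      simp only [hh, hta, hsa, if_true]
      rw [abs_sub_comm, abs_of_nonneg (by linarith)] at hd
      refine ⟨hd.le, fun he => ?_⟩
      rw [he, dist_self] at hd
      linarith
    · push Not at hta
      by_cases hsa : s ≤ a
      · simp only [hh, hta.not_ge, hsa, if_true, if_false]
        constructor
        · have h1 := hf s ⟨hs0, hsa⟩ a ⟨ha, le_rfl⟩
          have h2 := hg 0 ⟨le_rfl, hb⟩ (t - a) ⟨by linarith, by linarith⟩
          rw [abs_sub_comm, abs_of_nonneg (by linarith)] at h1
          rw [zero_sub, abs_neg, abs_of_nonneg (by linarith)] at h2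
          have := dist_triangle (f s) (f a) (g (t - a))
          rw [h1, hfg, h2] at this
          linarith
        · intro he
          have hs := hinj s ⟨hs0, hsa⟩ (t - a) ⟨by linarith, by linarith⟩ he
          have h2 := hg 0 ⟨le_rfl, hb⟩ (t - a) ⟨by linarith, by linarith⟩
          rw [zero_sub, abs_neg, abs_of_nonneg (by linarith), ← hfg, ← he, hs, dist_self] at h2
          linarith
      · push Not at hsa
        have hd := hg (s - a) ⟨by linarith, by linarith⟩ (t - a) ⟨by linarith, by linarith⟩
        simp only [hh, hta.not_ge, hsa.not_ge, if_false]
        rw [abs_sub_comm, abs_of_nonneg (by linarith)] at hd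
        refine ⟨by linarith, fun he => ?_⟩
        rw [he, dist_self] at hd
        linarith
  have hmem : ∀ t : unitInterval, (a + b) * t ∈ Icc (0 : ℝ) (a + b) := fun t =>
    ⟨mul_nonneg hab.le t.2.1, mul_le_of_le_one_right hab.le t.2.2⟩
  have hcont : Continuous fun t : unitInterval => h ((a + b) * t) := by
    refine (LipschitzWith.of_dist_le_mul (K := ⟨a + b, hab.le⟩) fun s t => ?_).continuous
    change _ ≤ (a + b) * dist s t
    rw [Subtype.dist_eq, Real.dist_eq]
    rcases le_total s t with hst | hst
    · have := (hlip _ (hmem s) _ (hmem t) (mul_le_mul_of_nonneg_left hst hab.le)).1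
      have hst' : (s : ℝ) ≤ t := hst
      rw [abs_sub_comm, abs_of_nonneg (by linarith)]
      linarith
    · have := (hlip _ (hmem t) _ (hmem s) (mul_le_mul_of_nonneg_left hst hab.le)).1
      have hst' : (t : ℝ) ≤ s := hst
      rw [abs_of_nonneg (by linarith), dist_comm]
      linarith
  refine ⟨⟨⟨fun t => h ((a + b) * t), hcont⟩, ?_, ?_⟩, ?_, ?_, ?_⟩
  · simp [hh, ha]
  · simp only [hh, Set.Icc.coe_one, mul_one]
    split_ifs with hle
    · have : b = 0 := by linarith
      simp [this, hfg]
    · congr 1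
      ring
  · intro s t hst
    change h _ = h _ at hst
    refine Subtype.ext (mul_left_cancel₀ hab.ne' ?_)
    rcases le_total s t with hle | hle
    · exact (hlip _ (hmem s) _ (hmem t) (mul_le_mul_of_nonneg_left hle hab.le)).2 hst
    · exact ((hlip _ (hmem t) _ (hmem s) (mul_le_mul_of_nonneg_left hle hab.le)).2 hst.symm).symm
  · refine ⟨⟨a / (a + b), by positivity, div_le_one_of_le₀ (by linarith) hab.le⟩, ?_⟩
    change h _ = _
    simp [hh, mul_div_cancel₀ _ hab.ne']
  · rintro _ ⟨t, rfl⟩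
    change h _ ∈ _
    obtain ⟨h0, h1⟩ := hmem t
    by_cases hle : (a + b) * (t : ℝ) ≤ a
    · exact Or.inl ⟨_, ⟨h0, hle⟩, by simp [hh, hle]⟩
    · push Not at hle
      exact Or.inr ⟨(a + b) * t - a, ⟨by linarith, by linarith⟩, by simp [hh, hle.not_ge]⟩

lemma geodesic_mem_seg {f : ℝ → T} {a : ℝ}
    (hf : ∀ s ∈ Icc (0 : ℝ) a, ∀ t ∈ Icc (0 : ℝ) a, dist (f s) (f t) = |s - t|)
    {s : ℝ} (hs : s ∈ Icc (0 : ℝ) a) : f s ∈ seg (f 0) (f a) := by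
  have ha := hs.1.trans hs.2
  rw [mem_seg, hf 0 ⟨le_rfl, ha⟩ s hs, hf s hs a ⟨ha, le_rfl⟩, hf 0 ⟨le_rfl, ha⟩ a ⟨ha, le_rfl⟩,
    abs_of_nonpos (by linarith [hs.1]), abs_of_nonpos (by linarith [hs.2]),
    abs_of_nonpos (by linarith)]
  ring

lemma continuousOn_of_geodesic {f : ℝ → T} {a : ℝ}
    (hf : ∀ s ∈ Icc (0 : ℝ) a, ∀ t ∈ Icc (0 : ℝ) a, dist (f s) (f t) = |s - t|) :
    ContinuousOn f (Icc 0 a) :=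
  (LipschitzOnWith.of_dist_le_mul (K := 1) fun s hs t ht => by
    simp [hf s hs t ht, Real.dist_eq]).continuousOn

namespace IsRTree

/-- A side of a triangle in an `ℝ`-tree is covered by the two other sides. -/
lemma seg_subset_union (hT : IsRTree T) (x z y : T) : seg x y ⊆ seg x z ∪ seg z y := by
  intro p hp
  rcases eq_or_ne x y with rfl | hxy
  · rw [eq_of_mem_seg_self hp]
    exact Or.inl (left_mem_seg _ _)
  have hd : 0 < dist x y := dist_pos.2 hxy
  obtain ⟨γ₁, hγ₁, hpγ₁⟩ : ∃ γ : Path x y, Function.Injective γ ∧ p ∈ Set.range γ := by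
    obtain ⟨f, hf0, hf1, hf⟩ := hT.exists_geod x p
    obtain ⟨g, hg0, hg1, hg⟩ := hT.exists_geod p y
    obtain ⟨γ, h1, h2, -⟩ := exists_injective_path_of_geodesics dist_nonneg dist_nonneg
      (by rw [mem_seg.1 hp]; exact hd) hf hg (hf1.trans hg0.symm) (by
        intro s hs t ht hst
        have h1 := geodesic_mem_seg hf hs
        have h2 := geodesic_mem_seg hg ht
        have h3 := hf s hs _ ⟨dist_nonneg, le_rfl⟩
        rw [← hst, hg0] at h2
        rw [hf0, hf1] at h1
        rw [hf1] at h3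
        rw [hg1] at h2
        rw [mem_seg] at h1 h2 hp
        have h4 := dist_triangle x (f s) y
        have h5 : dist (f s) p = 0 := by
          have := dist_comm p (f s)
          have := dist_nonneg (x := f s) (y := p)
          linarith
        rw [h5, eq_comm, abs_eq_zero] at h3
        linarith)
    exact ⟨γ.cast hf0.symm hg1.symm, h1, by rwa [hf1] at h2⟩
  obtain ⟨γ₂, hγ₂, hsub⟩ : ∃ γ : Path x y, Function.Injective γ ∧
      Set.range γ ⊆ seg x z ∪ seg z y := by
    obtain ⟨f, hf0, hf1, hf⟩ := hT.exists_geod x z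
    obtain ⟨h, hh0, hh1, hh⟩ := hT.exists_geod y z
    have hfc := continuousOn_of_geodesic hf
    have hhc := continuousOn_of_geodesic hh
    have hclosed : IsClosed (h '' Icc 0 (dist y z)) :=
      (isCompact_Icc.image_of_continuousOn hhc).isClosed
    obtain ⟨a, ⟨ha, t₀, ht₀, hat₀⟩, hmin⟩ :=
      (isCompact_Icc.of_isClosed_subset (hfc.preimage_isClosed_of_isClosed isClosed_Icc hclosed)
        inter_subset_left).exists_isLeast
        ⟨dist x z, ⟨dist_nonneg, le_rfl⟩, dist y z, ⟨dist_nonneg, le_rfl⟩, by rw [hh1, hf1]⟩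
    have hg : ∀ s ∈ Icc (0 : ℝ) t₀, t₀ - s ∈ Icc (0 : ℝ) (dist y z) := fun s hs =>
      ⟨by linarith [hs.2], by linarith [hs.1, ht₀.2]⟩
    have hfI : ∀ s ∈ Icc (0 : ℝ) a, s ∈ Icc (0 : ℝ) (dist x z) := fun s hs =>
      ⟨hs.1, hs.2.trans ha.2⟩
    have hpos : 0 < a + t₀ := by
      rcases (add_nonneg ha.1 ht₀.1).lt_or_eq with h0 | h0
      · exact h0
      · have h1 : a = 0 := by linarith [ha.1, ht₀.1]
        have h2 : t₀ = 0 := by linarith [ha.1, ht₀.1]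
        rw [h1, h2, hh0, hf0] at hat₀
        exact absurd hat₀.symm hxy
    obtain ⟨γ, h1, -, h2⟩ := exists_injective_path_of_geodesics (f := f)
      (g := fun s => h (t₀ - s)) ha.1 ht₀.1 hpos
      (fun s hs t ht => hf s (hfI s hs) t (hfI t ht))
      (fun s hs t ht => by
        rw [hh _ (hg s hs) _ (hg t ht), abs_sub_comm]
        congr 1
        ring)
      (by simp [hat₀])
      (fun s hs t ht hst => le_antisymm hs.2 (hmin ⟨hfI s hs, t₀ - t, hg t ht, hst.symm⟩))
    refine ⟨γ.cast hf0.symm (by simp [hh0]), h1, h2.trans (union_subset_union ?_ ?_)⟩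
    · rintro _ ⟨s, hs, rfl⟩
      have := geodesic_mem_seg hf (hfI s hs)
      rwa [hf0, hf1] at this
    · rintro _ ⟨s, hs, rfl⟩
      have := geodesic_mem_seg hh (hg s hs)
      rwa [hh0, hh1, seg_comm] at this
  rw [hT.arc_unique x y γ₁ γ₂ hγ₁ hγ₂] at hpγ₁
  exact hsub hpγ₁

lemma seg_subset_of_isPreconnected (hT : IsRTree T) {S : Set T} (hS : IsPreconnected S)
    {x y : T} (hx : x ∈ S) (hy : y ∈ S) : seg x y ⊆ S := by
  intro p hp
  by_contra hpS
  have hU : IsOpen {z | dist x z < dist x p + dist p z} :=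
    isOpen_lt (by fun_prop) (by fun_prop)
  have hV : IsOpen {z | z ≠ p ∧ p ∈ seg x z} := by
    rw [Metric.isOpen_iff]
    rintro z ⟨hzp, hz⟩
    refine ⟨dist z p, dist_pos.2 hzp, fun z' hz' => ⟨?_, ?_⟩⟩
    · rintro rfl
      rw [Metric.mem_ball, dist_comm] at hz'
      exact lt_irrefl _ hz'
    · rcases hT.seg_subset_union x z' z hz with h | h
      · exact h
      · rw [mem_seg] at h
        rw [Metric.mem_ball] at hz'
        linarith [dist_nonneg (x := z') (y := p), dist_comm p z]
  have hxp : x ≠ p := fun h => hpS (h ▸ hx)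
  have hyp : y ≠ p := fun h => hpS (h ▸ hy)
  obtain ⟨z, -, hz1, -, hz2⟩ := hS _ _ hU hV
    (fun z hz => by
      by_cases h : p ∈ seg x z
      · exact Or.inr ⟨fun h => hpS (h ▸ hz), h⟩
      · exact Or.inl (lt_of_le_of_ne (dist_triangle _ _ _) (fun h' => h h'.symm)))
    ⟨x, hx, by
      have := dist_pos.2 hxp
      simp only [mem_ofPred_eq, dist_self]
      linarith [dist_nonneg (x := p) (y := x)]⟩
    ⟨y, hy, hyp, hp⟩
  exact hz1.ne (mem_seg.1 hz2).symm

lemma isPreconnected_seg (hT : IsRTree T) (x y : T) : IsPreconnected (seg x y) := by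
  obtain ⟨f, hf0, hf1, hf⟩ := hT.exists_geod x y
  have hpre := isPreconnected_Icc.image f (continuousOn_of_geodesic hf)
  have hsub := hT.seg_subset_of_isPreconnected hpre ⟨0, ⟨le_rfl, dist_nonneg⟩, hf0⟩
    ⟨_, ⟨dist_nonneg, le_rfl⟩, hf1⟩
  convert! hpre
  refine hsub.antisymm ?_
  rintro _ ⟨s, hs, rfl⟩
  have := geodesic_mem_seg hf hs
  rwa [hf0, hf1] at this

lemma exists_mem_seg_dist_eq (hT : IsRTree T) {x y : T} {r : ℝ} (hr : 0 ≤ r)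
    (hrd : r ≤ dist x y) : ∃ p ∈ seg x y, dist x p = r := by
  obtain ⟨f, hf0, hf1, hf⟩ := hT.exists_geod x y
  have h := geodesic_mem_seg hf ⟨hr, hrd⟩
  rw [hf0, hf1] at h
  refine ⟨f r, h, ?_⟩
  have := hf 0 ⟨le_rfl, dist_nonneg⟩ r ⟨hr, hrd⟩
  rwa [hf0, zero_sub, abs_neg, abs_of_nonneg hr] at this

/-- A point `x` at distance at least `ε` from `y` lies in a direction based at a point `p` near
`x` and separating `y` from this direction. -/
lemma exists_direction_separating (hT : IsRTree T) {x y : T} {ε : ℝ} (hε : 0 < ε)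
    (hxy : ε ≤ dist x y) :
    ∃ p : T, ∃ δ : Set T, dist p x < ε ∧ IsDirection δ ∧ x ∈ δ ∧
      (∀ z ∈ δ, p ∈ seg y z) ∧ (∀ z ∈ δ, ∀ w ∈ δ, p ∉ seg z w) ∧
      ∀ z, p ∉ seg x z → z ∈ δ := by
  obtain ⟨p, hp, hpd⟩ := hT.exists_mem_seg_dist_eq (r := ε / 2) (by linarith)
    (show ε / 2 ≤ dist x y by linarith)
  have hxp : x ≠ p := dist_pos.1 (by linarith)
  have hsep : ∀ z ∈ connectedComponentIn {p}ᶜ x, ∀ w ∈ connectedComponentIn {p}ᶜ x,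
      p ∉ seg z w := fun z hz w hw h =>
    connectedComponentIn_subset {p}ᶜ x
      (hT.seg_subset_of_isPreconnected isPreconnected_connectedComponentIn hz hw h) rfl
  have hx : x ∈ connectedComponentIn {p}ᶜ x := mem_connectedComponentIn hxp
  refine ⟨p, connectedComponentIn {p}ᶜ x, by rw [dist_comm]; linarith, ⟨p, x, hxp, rfl⟩, hx,
    fun z hz => ?_, hsep, fun z hz => ?_⟩
  · rcases hT.seg_subset_union x z y hp with h | h
    · exact absurd h (hsep x hx z hz)
    · rwa [seg_comm]
  · exact (hT.isPreconnected_seg x z).subset_connectedComponentIn (left_mem_seg _ _)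
      (subset_compl_singleton_iff.2 hz) (right_mem_seg _ _)

end IsRTree

end Segments

/-! ### Foliated complexes -/

lemma dist_add_dist_le_sum {T : Type*} [MetricSpace T] {n : ℕ} (p : Fin (n + 1) → T)
    (i : Fin (n + 1)) :
    dist (p 0) (p i) + dist (p i) (p (Fin.last n)) ≤
      ∑ j : Fin n, dist (p j.castSucc) (p j.succ) := by
  induction n with
  | zero =>
    obtain rfl : i = 0 := Fin.fin_one_eq_zero i
    simp
  | succ n ih =>
    rw [Fin.sum_univ_castSucc]
    have ih' := ih (fun j => p j.castSucc)
    simp only [Fin.castSucc_zero, ← Fin.succ_castSucc] at ih' ⊢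
    rw [Fin.succ_last]
    refine Fin.lastCases ?_ (fun j => ?_) i
    · have := ih' (Fin.last n)
      simp only [dist_self, add_zero] at this ⊢
      exact (dist_triangle _ _ _).trans (by gcongr)
    · have := ih' j
      have := dist_triangle (p j.castSucc) (p (Fin.last n).castSucc) (p (Fin.last (n + 1)))
      linarith

namespace GeometricStructure

variable {G T : Type*} [Group G] [MetricSpace T] [MulAction G T] (𝒢 : GeometricStructure G T)

include 𝒢 in
lemma exists_common_vertex {s t : Finset (Amb G)} (hs : s ∈ 𝒢.K.faces) (ht : t ∈ 𝒢.K.faces)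
    {x : Amb G} (hxs : x ∈ convexHull ℝ (s : Set (Amb G)))
    (hxt : x ∈ convexHull ℝ (t : Set (Amb G))) : ∃ v, v ∈ s ∧ v ∈ t := by
  have h : (convexHull ℝ (s ∩ t : Set (Amb G))).Nonempty :=
    ⟨x, 𝒢.K.inter_subset_convexHull hs ht ⟨hxs, hxt⟩⟩
  exact convexHull_nonempty_iff.1 h

lemma mem_space {s : Finset (Amb G)} (hs : s ∈ 𝒢.K.faces) {x : Amb G}
    (hx : x ∈ convexHull ℝ (s : Set (Amb G))) : x ∈ 𝒢.K.space :=
  𝒢.K.convexHull_subset_space hs hx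

lemma vertex_mem_space {s : Finset (Amb G)} (hs : s ∈ 𝒢.K.faces) {v : Amb G} (hv : v ∈ s) :
    v ∈ 𝒢.K.space :=
  𝒢.K.subset_space hs hv

lemma ρ_mul_apply (g h : G) (x : Amb G) : 𝒢.ρ (g * h) x = 𝒢.ρ g (𝒢.ρ h x) := by
  rw [map_mul]
  rfl

lemma ρ_inv_apply_self (g : G) (x : Amb G) : 𝒢.ρ g⁻¹ (𝒢.ρ g x) = x := by
  rw [← ρ_mul_apply, inv_mul_cancel, map_one]
  rfl

lemma ρ_mem_convexHull_image (g : G) {s : Finset (Amb G)} {x : Amb G}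
    (hx : x ∈ convexHull ℝ (s : Set (Amb G))) :
    𝒢.ρ g x ∈ convexHull ℝ ((Finset.image (𝒢.ρ g) s : Finset (Amb G)) : Set (Amb G)) := by
  rw [Finset.coe_image]
  exact (AffineMap.image_convexHull (𝒢.ρ g).toAffineMap (s : Set (Amb G))).subset ⟨x, hx, rfl⟩

lemma exists_ρ_eq_of_mem_convexHull_image (g : G) {s : Finset (Amb G)} {x : Amb G}
    (hx : x ∈ convexHull ℝ ((Finset.image (𝒢.ρ g) s : Finset (Amb G)) : Set (Amb G))) :
    ∃ y ∈ convexHull ℝ (s : Set (Amb G)), 𝒢.ρ g y = x := by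
  rw [Finset.coe_image] at hx
  exact (AffineMap.image_convexHull (𝒢.ρ g).toAffineMap (s : Set (Amb G))).superset hx

lemma ρ_mem_space (g : G) {x : Amb G} (hx : x ∈ 𝒢.K.space) : 𝒢.ρ g x ∈ 𝒢.K.space := by
  obtain ⟨s, hs, hxs⟩ := 𝒢.K.mem_space_iff.1 hx
  exact 𝒢.mem_space (𝒢.mapsFaces g s hs) (𝒢.ρ_mem_convexHull_image g hxs)

lemma dist_proj_le {s : Finset (Amb G)} (hs : s ∈ 𝒢.K.faces) {x y : Amb G}
    (hx : x ∈ convexHull ℝ (s : Set (Amb G))) (hy : y ∈ convexHull ℝ (s : Set (Amb G))) :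
    dist (𝒢.proj x) (𝒢.proj y) ≤ |𝒢.fol s x - 𝒢.fol s y| := by
  rw [← ENNReal.ofReal_le_ofReal_iff (abs_nonneg _),
    𝒢.proj_dist x (𝒢.mem_space hs hx) y (𝒢.mem_space hs hy)]
  refine (iInf_le _ 1).trans ((iInf_le _ ![x, y]).trans ((iInf_le _ fun _ => s).trans
    ((iInf_le _ rfl).trans ((iInf_le _ rfl).trans ((iInf_le _ ?_).trans ?_)))))
  · intro i
    rw [Subsingleton.elim i 0]
    exact ⟨hs, hx, hy⟩
  · simp

/-- Points of the complex are joined by chains whose projections are almost geodesic. -/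
lemma exists_chain {x y : Amb G} (hx : x ∈ 𝒢.K.space) (hy : y ∈ 𝒢.K.space) {η : ℝ} (hη : 0 < η) :
    ∃ (n : ℕ) (c : Fin (n + 1) → Amb G) (S : Fin n → Finset (Amb G)),
      c 0 = x ∧ c (Fin.last n) = y ∧
      (∀ i : Fin n, S i ∈ 𝒢.K.faces ∧ c i.castSucc ∈ convexHull ℝ (S i : Set (Amb G)) ∧
        c i.succ ∈ convexHull ℝ (S i : Set (Amb G))) ∧
      ∀ i, dist (𝒢.proj x) (𝒢.proj (c i)) + dist (𝒢.proj (c i)) (𝒢.proj y) <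
        dist (𝒢.proj x) (𝒢.proj y) + η := by
  have hlt : foliationDist 𝒢.K 𝒢.fol x y <
      ENNReal.ofReal (dist (𝒢.proj x) (𝒢.proj y) + η) := by
    rw [← 𝒢.proj_dist x hx y hy, ENNReal.ofReal_lt_ofReal_iff_of_nonneg dist_nonneg]
    linarith
  simp only [foliationDist, iInf_lt_iff] at hlt
  obtain ⟨n, c, S, rfl, rfl, hS, hlt⟩ := hlt
  refine ⟨n, c, S, rfl, rfl, hS, fun i => ?_⟩
  rw [← ENNReal.ofReal_sum_of_nonneg (fun _ _ => abs_nonneg _), ENNReal.ofReal_lt_ofReal_iff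
    (by positivity)] at hlt
  calc _ ≤ ∑ j : Fin n, dist (𝒢.proj (c j.castSucc)) (𝒢.proj (c j.succ)) :=
        dist_add_dist_le_sum (fun j => 𝒢.proj (c j)) i
    _ ≤ ∑ j : Fin n, |𝒢.fol (S j) (c j.castSucc) - 𝒢.fol (S j) (c j.succ)| :=
        Finset.sum_le_sum fun j _ => 𝒢.dist_proj_le (hS j).1 (hS j).2.1 (hS j).2.2
    _ < _ := hlt

/-- A property of vertices which propagates along faces meeting the almost geodesic region
between `x` and `y` propagates from `x` to `y`. -/
lemma propagate {x y : Amb G} (hx : x ∈ 𝒢.K.space) (hy : y ∈ 𝒢.K.space) {η : ℝ} (hη : 0 < η)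
    {Φ : Amb G → Prop}
    (hΦ : ∀ s ∈ 𝒢.K.faces, ∀ u ∈ convexHull ℝ (s : Set (Amb G)),
      dist (𝒢.proj x) (𝒢.proj u) + dist (𝒢.proj u) (𝒢.proj y) <
        dist (𝒢.proj x) (𝒢.proj y) + η → ∀ v ∈ s, ∀ w ∈ s, Φ v → Φ w)
    {s : Finset (Amb G)} (hs : s ∈ 𝒢.K.faces) (hxs : x ∈ convexHull ℝ (s : Set (Amb G)))
    {v : Amb G} (hv : v ∈ s) (hΦv : Φ v)
    {t : Finset (Amb G)} (ht : t ∈ 𝒢.K.faces) (hyt : y ∈ convexHull ℝ (t : Set (Amb G)))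
    {w : Amb G} (hw : w ∈ t) : Φ w := by
  obtain ⟨n, c, S, h0, h1, hS, hc⟩ := 𝒢.exists_chain hx hy hη
  have key : ∀ i, ∀ t ∈ 𝒢.K.faces, c i ∈ convexHull ℝ (t : Set (Amb G)) → ∀ w ∈ t, Φ w := by
    intro i
    induction i using Fin.induction with
    | zero =>
      intro t ht hct w hw
      have hcs : c 0 ∈ convexHull ℝ (s : Set (Amb G)) := by rwa [h0]
      obtain ⟨a, has, hat⟩ := 𝒢.exists_common_vertex hs ht hcs hct
      exact hΦ t ht _ hct (hc 0) a hat w hw (hΦ s hs _ hcs (hc 0) v hv a has hΦv)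
    | succ i ih =>
      intro t ht hct w hw
      obtain ⟨hSi, hi, hi'⟩ := hS i
      obtain ⟨a, haS, hat⟩ := 𝒢.exists_common_vertex hSi ht hi' hct
      exact hΦ t ht _ hct (hc i.succ) a hat w hw (ih _ hSi hi a haS)
  exact key (Fin.last n) t ht (by rwa [h1]) w hw

lemma seg_proj_subset (hT : IsRTree T) {s : Finset (Amb G)} (hs : s ∈ 𝒢.K.faces) {x y : Amb G}
    (hx : x ∈ convexHull ℝ (s : Set (Amb G))) (hy : y ∈ convexHull ℝ (s : Set (Amb G))) :
    seg (𝒢.proj x) (𝒢.proj y) ⊆ 𝒢.proj '' convexHull ℝ (s : Set (Amb G)) := by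
  have hmem : ∀ r ∈ Icc (0 : ℝ) 1, AffineMap.lineMap x y r ∈ convexHull ℝ (s : Set (Amb G)) :=
    fun r hr => (convex_convexHull ℝ _).lineMap_mem hx hy hr
  have hcont : ContinuousOn (fun r : ℝ => 𝒢.proj (AffineMap.lineMap x y r)) (Icc 0 1) := by
    refine (LipschitzOnWith.of_dist_le_mul (K := ⟨|𝒢.fol s y - 𝒢.fol s x|, abs_nonneg _⟩)
      fun a ha b hb => (𝒢.dist_proj_le hs (hmem a ha) (hmem b hb)).trans_eq ?_).continuousOn
    change _ = |𝒢.fol s y - 𝒢.fol s x| * dist a b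
    rw [AffineMap.apply_lineMap, AffineMap.apply_lineMap, Real.dist_eq, ← abs_mul]
    congr 1
    simp only [AffineMap.lineMap_apply, vsub_eq_sub, smul_eq_mul, vadd_eq_add]
    ring
  have hpre := isPreconnected_Icc.image _ hcont
  refine (hT.seg_subset_of_isPreconnected hpre ⟨0, by simp, by simp⟩ ⟨1, by simp, by simp⟩).trans ?_
  rintro _ ⟨r, hr, rfl⟩
  exact ⟨_, hmem r hr, rfl⟩

/-- Segments of the tree are covered by the projections of finitely many faces. -/
lemma exists_finite_cover_seg (hT : IsRTree T) (a b : T) :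
    ∃ A : Set (Finset (Amb G)), A.Finite ∧ A ⊆ 𝒢.K.faces ∧
      ∀ p ∈ seg a b, ∃ s ∈ A, ∃ u ∈ convexHull ℝ (s : Set (Amb G)), 𝒢.proj u = p := by
  obtain ⟨x, hx, rfl⟩ := 𝒢.proj_surjective a
  obtain ⟨y, hy, rfl⟩ := 𝒢.proj_surjective b
  obtain ⟨s, hs, hxs⟩ := 𝒢.K.mem_space_iff.1 hx
  obtain ⟨n, c, S, h0, h1, hS, -⟩ := 𝒢.exists_chain hx hy one_pos
  refine ⟨insert s (range S), (finite_range S).insert s,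
    insert_subset hs (range_subset_iff.2 fun i => (hS i).1), ?_⟩
  have key : ∀ i, ∀ p ∈ seg (𝒢.proj x) (𝒢.proj (c i)),
      ∃ t ∈ insert s (range S), ∃ u ∈ convexHull ℝ (t : Set (Amb G)), 𝒢.proj u = p := by
    intro i
    induction i using Fin.induction with
    | zero =>
      intro p hp
      rw [h0] at hp
      exact ⟨s, mem_insert _ _, x, hxs, (eq_of_mem_seg_self hp).symm⟩
    | succ i ih =>
      intro p hp
      rcases hT.seg_subset_union _ (𝒢.proj (c i.castSucc)) _ hp with h | h
      · exact ih p h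
      · exact ⟨S i, mem_insert_of_mem _ ⟨i, rfl⟩,
          𝒢.seg_proj_subset hT (hS i).1 (hS i).2.1 (hS i).2.2 h⟩
  simpa only [h1] using key (Fin.last n)

/-- The projection of a face is the union of the projections of its edges. -/
lemma exists_proj_mem_seg {s : Finset (Amb G)} (hs : s ∈ 𝒢.K.faces) {u : Amb G}
    (hu : u ∈ convexHull ℝ (s : Set (Amb G))) :
    ∃ v ∈ s, ∃ w ∈ s, 𝒢.proj u ∈ seg (𝒢.proj v) (𝒢.proj w) := by
  have hne := 𝒢.K.nonempty_of_mem_faces hs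
  obtain ⟨v, hv, hmin⟩ := s.exists_min_image (𝒢.fol s) hne
  obtain ⟨w, hw, hmax⟩ := s.exists_max_image (𝒢.fol s) hne
  have hle : 𝒢.fol s v ≤ 𝒢.fol s u :=
    convexHull_min (s := (s : Set (Amb G))) (t := 𝒢.fol s ⁻¹' Ici (𝒢.fol s v)) hmin
      ((convex_Ici _).affine_preimage _) hu
  have hge : 𝒢.fol s u ≤ 𝒢.fol s w :=
    convexHull_min (s := (s : Set (Amb G))) (t := 𝒢.fol s ⁻¹' Iic (𝒢.fol s w)) hmax
      ((convex_Iic _).affine_preimage _) hu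
  have hsub : ({v, w} : Finset (Amb G)) ⊆ s := by
    simp [Finset.insert_subset_iff, hv, hw]
  have hface := 𝒢.K.down_closed hs hsub ⟨v, by simp⟩
  have hvc : v ∈ convexHull ℝ ((({v, w} : Finset (Amb G))) : Set (Amb G)) :=
    subset_convexHull ℝ _ (by simp)
  have hwc : w ∈ convexHull ℝ ((({v, w} : Finset (Amb G))) : Set (Amb G)) :=
    subset_convexHull ℝ _ (by simp)
  obtain ⟨e, c, he, hcompat⟩ := 𝒢.fol_compat s hs _ hface hsub
  have hvw : dist (𝒢.proj v) (𝒢.proj w) = 𝒢.fol s w - 𝒢.fol s v := by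
    rw [𝒢.edges_embed _ hface Finset.card_le_two v hvc w hwc, hcompat v hvc, hcompat w hwc]
    rcases he with rfl | rfl
    · rw [abs_of_nonpos (by linarith)]
      ring
    · rw [abs_of_nonneg (by linarith)]
      ring
  have h1 := 𝒢.dist_proj_le hs (subset_convexHull ℝ _ hv) hu
  have h2 := 𝒢.dist_proj_le hs hu (subset_convexHull ℝ _ hw)
  rw [abs_of_nonpos (by linarith)] at h1 h2
  exact ⟨v, hv, w, hw, le_antisymm (by linarith) (dist_triangle _ _ _)⟩

include 𝒢 in
/-- The action on the complex being free, there are equivariant maps to any `G`-set. -/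
lemma exists_equivariant {X : Type*} [MulAction G X] (x₀ : X) :
    ∃ φ : Amb G → X, ∀ (g : G), ∀ x ∈ 𝒢.K.space, φ (𝒢.ρ g x) = g • φ x := by
  let orb : Setoid (Amb G) :=
    { r := fun x y => ∃ g, 𝒢.ρ g x = y
      iseqv := ⟨fun x => ⟨1, by simp⟩,
        fun {x y} ⟨g, hg⟩ => ⟨g⁻¹, by rw [← hg, ρ_inv_apply_self]⟩,
        fun {x y z} ⟨g, hg⟩ ⟨h, hh⟩ => ⟨h * g, by rw [ρ_mul_apply, hg, hh]⟩⟩ }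
  have hrep : ∀ x : Amb G, ∃ g, 𝒢.ρ g (Quotient.mk orb x).out = x := fun x =>
    Quotient.exact (s := orb) (Quotient.out_eq (Quotient.mk orb x))
  choose h hh using hrep
  refine ⟨fun x => h x • x₀, fun g x hx => ?_⟩
  have hq : Quotient.mk orb (𝒢.ρ g x) = Quotient.mk orb x :=
    (Quotient.sound (s := orb) ⟨g, rfl⟩).symm
  have h1 := hh (𝒢.ρ g x)
  rw [hq] at h1
  have hfix : 𝒢.ρ ((g * h x)⁻¹ * h (𝒢.ρ g x)) (Quotient.mk orb x).out =
      (Quotient.mk orb x).out := by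
    rw [ρ_mul_apply, h1, mul_inv_rev, ρ_mul_apply, ρ_inv_apply_self]
    exact (congrArg _ (hh x).symm).trans (𝒢.ρ_inv_apply_self _ _)
  have hspace : (Quotient.mk orb x).out ∈ 𝒢.K.space := by
    rw [← 𝒢.ρ_inv_apply_self (h x) (Quotient.mk orb x).out, hh x]
    exact 𝒢.ρ_mem_space _ hx
  have hone : (g * h x)⁻¹ * h (𝒢.ρ g x) = 1 := by
    by_contra hne
    exact 𝒢.freeAct _ hne _ hspace hfix
  change h (𝒢.ρ g x) • x₀ = g • h x • x₀
  rw [smul_smul, inv_mul_eq_one.1 hone]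

end GeometricStructure

/-! ### The core and foliated complexes -/

section Core

variable {G T₁ T₂ : Type*} [Group G] [MetricSpace T₁] [MetricSpace T₂] [MulAction G T₁]
  [MulAction G T₂]

/-- The core is contained in the closure of any set `F` containing the products of the hulls of
the `φ`-images of faces of the first complex with leaves (condition `hA`), and whose vertical
slices link these to the products of the hulls of the `ψ`-images of faces of the second complex
with leaves (condition `hB`). -/
lemma core_subset_closure (hT₁ : IsRTree T₁) (hT₂ : IsRTree T₂)
    (𝒢₁ : GeometricStructure G T₁) (𝒢₂ : GeometricStructure G T₂)
    {φ : Amb G → T₂} {ψ : Amb G → T₁}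
    (hψ : ∀ (g : G), ∀ x ∈ 𝒢₂.K.space, ψ (𝒢₂.ρ g x) = g • ψ x)
    {F : Set (T₁ × T₂)}
    (hA : ∀ s ∈ 𝒢₁.K.faces, ∀ u ∈ convexHull ℝ (s : Set (Amb G)), ∀ v ∈ s, ∀ w ∈ s,
      ∀ t ∈ seg (φ v) (φ w), (𝒢₁.proj u, t) ∈ F)
    (hB : ∀ s ∈ 𝒢₂.K.faces, ∀ u ∈ convexHull ℝ (s : Set (Amb G)), ∀ v ∈ s, ∀ w ∈ s,
      ∀ x ∈ seg (ψ v) (ψ w), ∃ s' ∈ 𝒢₁.K.faces, ∃ u' ∈ convexHull ℝ (s' : Set (Amb G)),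
        𝒢₁.proj u' = x ∧ ∃ v' ∈ s', ∀ t ∈ seg (φ v') (𝒢₂.proj u), (x, t) ∈ F) :
    Core G T₁ T₂ ⊆ closure F := by
  rintro ⟨x₁, x₂⟩ hcore
  by_contra hcl
  obtain ⟨ε, hε, hF⟩ : ∃ ε > 0, ∀ q ∈ F, dist q.1 x₁ < ε → ε ≤ dist q.2 x₂ := by
    rw [Metric.mem_closure_iff] at hcl
    push Not at hcl
    obtain ⟨ε, hε, h⟩ := hcl
    refine ⟨ε, hε, fun q hq h1 => ?_⟩
    have h2 := h q hq
    rw [dist_comm, Prod.dist_eq, le_max_iff] at h2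
    exact h2.resolve_left h1.not_ge
  let W : Set T₂ := {t | ∃ x, dist x x₁ < ε ∧ (x, t) ∈ F}
  obtain ⟨u₀, hu₀, hu₀x⟩ := 𝒢₁.proj_surjective x₁
  obtain ⟨s₀, hs₀, hus₀⟩ := 𝒢₁.K.mem_space_iff.1 hu₀
  obtain ⟨v₀, hv₀⟩ := 𝒢₁.K.nonempty_of_mem_faces hs₀
  have hself : seg (φ v₀) (φ v₀) ⊆ W := fun t ht =>
    ⟨x₁, by simpa using hε, hu₀x ▸ hA s₀ hs₀ u₀ hus₀ v₀ hv₀ v₀ hv₀ t ht⟩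
  have hstar : ∀ s ∈ 𝒢₁.K.faces, ∀ u ∈ convexHull ℝ (s : Set (Amb G)),
      dist (𝒢₁.proj u) x₁ < ε → ∀ v ∈ s, seg (φ v₀) (φ v) ⊆ W := by
    intro s hs u hu hud v hv
    refine 𝒢₁.propagate (x := u₀) (y := u) (η := ε - dist (𝒢₁.proj u) x₁)
      (Φ := fun v => seg (φ v₀) (φ v) ⊆ W) hu₀ (𝒢₁.mem_space hs hu) (by linarith) ?_
      hs₀ hus₀ hv₀ hself hs hu hv
    intro t ht a ha had b hb c hc hbW
    refine (hT₂.seg_subset_union _ (φ b) _).trans (union_subset hbW fun p hp => ?_)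
    refine ⟨𝒢₁.proj a, ?_, hA t ht a ha b hb c hc p hp⟩
    rw [hu₀x, dist_comm x₁ (𝒢₁.proj u)] at had
    rw [dist_comm]
    linarith [dist_nonneg (x := 𝒢₁.proj a) (y := 𝒢₁.proj u)]
  have hWx₂ : ∀ t ∈ W, ε ≤ dist t x₂ := fun t ⟨x, hx, hxt⟩ => hF _ hxt hx
  obtain ⟨p₂, δ₂, hp₂, hδ₂, hxδ₂, hsep₂, hconv₂, hmem₂⟩ := hT₂.exists_direction_separating hε
    (show ε ≤ dist x₂ (φ v₀) by
      rw [dist_comm]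
      exact hWx₂ _ (hself (left_mem_seg _ _)))
  have hfar : ∀ s ∈ 𝒢₂.K.faces, ∀ u ∈ convexHull ℝ (s : Set (Amb G)), 𝒢₂.proj u ∈ δ₂ →
      ∀ v ∈ s, ∀ w ∈ s, ∀ x ∈ seg (ψ v) (ψ w), ε ≤ dist x x₁ := by
    intro s hs u hu huδ v hv w hw x hx
    by_contra! hlt
    obtain ⟨s', hs', u', hu', rfl, v', hv', hv'F⟩ := hB s hs u hu v hv w hw x hx
    refine (hWx₂ p₂ ?_).not_gt hp₂
    rcases hT₂.seg_subset_union _ (φ v') _ (hsep₂ _ huδ) with h | h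
    · exact hstar s' hs' u' hu' hlt v' hv' h
    · exact ⟨_, hlt, hv'F _ h⟩
  obtain ⟨u₁, hu₁, rfl⟩ := 𝒢₂.proj_surjective x₂
  obtain ⟨s₁, hs₁, hus₁⟩ := 𝒢₂.K.mem_space_iff.1 hu₁
  obtain ⟨v₁, hv₁⟩ := 𝒢₂.K.nonempty_of_mem_faces hs₁
  have hv₁far := hfar s₁ hs₁ u₁ hus₁ hxδ₂ v₁ hv₁ v₁ hv₁ _ (left_mem_seg _ _)
  obtain ⟨p₁, δ₁, hp₁, hδ₁, hxδ₁, hsep₁, -, -⟩ := hT₁.exists_direction_separating hε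
    (show ε ≤ dist x₁ (ψ v₁) by rwa [dist_comm])
  obtain ⟨γ, hγ, -⟩ := hcore (δ₁ ×ˢ δ₂) ⟨δ₁, δ₂, hδ₁, hδ₂, rfl⟩ ⟨hxδ₁, hxδ₂⟩
    (ψ v₁, 𝒢₂.proj v₁)
  obtain ⟨h1, h2⟩ := hγ 0
  have hv₁s := 𝒢₂.vertex_mem_space hs₁ hv₁
  rw [← hψ _ _ hv₁s] at h1
  rw [← 𝒢₂.proj_equivariant _ _ hv₁s] at h2
  set y := 𝒢₂.ρ (γ 0) v₁
  have hy : y ∈ 𝒢₂.K.space := 𝒢₂.ρ_mem_space _ hv₁s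
  have hys : y ∈ Finset.image (𝒢₂.ρ (γ 0)) s₁ := Finset.mem_image_of_mem _ hv₁
  have hexc : 0 < dist (𝒢₂.proj u₁) p₂ + dist p₂ (𝒢₂.proj y) -
      dist (𝒢₂.proj u₁) (𝒢₂.proj y) :=
    sub_pos.2 (lt_of_le_of_ne (dist_triangle _ _ _) fun h => hconv₂ _ hxδ₂ _ h2 h.symm)
  refine 𝒢₂.propagate (Φ := fun v => p₁ ∉ seg (ψ v₁) (ψ v)) hu₁ hy hexc ?_ hs₁ hus₁ hv₁ ?_
    (𝒢₂.mapsFaces (γ 0) s₁ hs₁) (subset_convexHull ℝ _ hys) hys (hsep₁ _ h1)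
  · intro s hs u hu hud v hv w hw hΦ hw'
    rcases hT₁.seg_subset_union _ (ψ v) _ hw' with h | h
    · exact hΦ h
    · refine (hfar s hs u hu (hmem₂ _ fun hpu => ?_) v hv w hw p₁ h).not_gt hp₁
      rw [mem_seg] at hpu
      linarith [dist_triangle p₂ (𝒢₂.proj u) (𝒢₂.proj y)]
  · intro h
    rw [eq_of_mem_seg_self h] at hp₁
    exact hp₁.not_ge hv₁far

/-- The products of segments given by finitely many faces satisfy the linking conditions. -/
lemma exists_finite_rectangles (hT₁ : IsRTree T₁) (hT₂ : IsRTree T₂)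
    (hiso₁ : IsometricAction G T₁) (hiso₂ : IsometricAction G T₂)
    (𝒢₁ : GeometricStructure G T₁) (𝒢₂ : GeometricStructure G T₂)
    {φ : Amb G → T₂} {ψ : Amb G → T₁}
    (hφ : ∀ (g : G), ∀ x ∈ 𝒢₁.K.space, φ (𝒢₁.ρ g x) = g • φ x)
    (hψ : ∀ (g : G), ∀ x ∈ 𝒢₂.K.space, ψ (𝒢₂.ρ g x) = g • ψ x) :
    ∃ (A : Set T₁) (B : Set T₂), A.Finite ∧ B.Finite ∧
      ∀ F : Set (T₁ × T₂),
      (∀ g : G, ∀ a ∈ A, ∀ b ∈ A, ∀ c ∈ B, ∀ d ∈ B, ∀ p ∈ seg a b, ∀ q ∈ seg c d,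
        (g • p, g • q) ∈ F) →
      (∀ s ∈ 𝒢₁.K.faces, ∀ u ∈ convexHull ℝ (s : Set (Amb G)), ∀ v ∈ s, ∀ w ∈ s,
        ∀ t ∈ seg (φ v) (φ w), (𝒢₁.proj u, t) ∈ F) ∧
      ∀ s ∈ 𝒢₂.K.faces, ∀ u ∈ convexHull ℝ (s : Set (Amb G)), ∀ v ∈ s, ∀ w ∈ s,
        ∀ x ∈ seg (ψ v) (ψ w), ∃ s' ∈ 𝒢₁.K.faces, ∃ u' ∈ convexHull ℝ (s' : Set (Amb G)),
          𝒢₁.proj u' = x ∧ ∃ v' ∈ s', ∀ t ∈ seg (φ v') (𝒢₂.proj u), (x, t) ∈ F := by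
  obtain ⟨R₁, hR₁, hR₁K, hR₁G⟩ := 𝒢₁.cocompact
  obtain ⟨R₂, hR₂, hR₂K, hR₂G⟩ := 𝒢₂.cocompact
  choose C hCfin hCK hC using fun a b => 𝒢₁.exists_finite_cover_seg hT₁ a b
  let E : Set (Finset (Amb G)) := R₁ ∪ ⋃ s ∈ R₂, ⋃ v ∈ s, ⋃ w ∈ s, C (ψ v) (ψ w)
  have hEfin : E.Finite := hR₁.union (hR₂.biUnion fun s _ =>
    s.finite_toSet.biUnion fun v _ => s.finite_toSet.biUnion fun w _ => hCfin _ _)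
  have hEK : E ⊆ 𝒢₁.K.faces := union_subset hR₁K (iUnion₂_subset fun s _ =>
    iUnion₂_subset fun v _ => iUnion₂_subset fun w _ => hCK _ _)
  have hVfin : (⋃ s ∈ E, (s : Set (Amb G))).Finite := hEfin.biUnion fun s _ => s.finite_toSet
  have hV₂fin : (⋃ s ∈ R₂, (s : Set (Amb G))).Finite := hR₂.biUnion fun s _ => s.finite_toSet
  refine ⟨𝒢₁.proj '' ⋃ s ∈ E, (s : Set (Amb G)),
    φ '' (⋃ s ∈ E, (s : Set (Amb G))) ∪ 𝒢₂.proj '' ⋃ s ∈ R₂, (s : Set (Amb G)),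
    hVfin.image _, (hVfin.image _).union (hV₂fin.image _), fun F hF => ?_⟩
  have hrect : ∀ g : G, ∀ s ∈ E, ∀ u ∈ convexHull ℝ (s : Set (Amb G)),
      ∀ c ∈ φ '' (⋃ s ∈ E, (s : Set (Amb G))) ∪ 𝒢₂.proj '' ⋃ s ∈ R₂, (s : Set (Amb G)),
      ∀ d ∈ φ '' (⋃ s ∈ E, (s : Set (Amb G))) ∪ 𝒢₂.proj '' ⋃ s ∈ R₂, (s : Set (Amb G)),
      ∀ q ∈ seg c d, (g • 𝒢₁.proj u, g • q) ∈ F := by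
    intro g s hs u hu c hc d hd q hq
    obtain ⟨a, ha, b, hb, hab⟩ := 𝒢₁.exists_proj_mem_seg (hEK hs) hu
    exact hF g _ (mem_image_of_mem _ (mem_biUnion hs ha)) _
      (mem_image_of_mem _ (mem_biUnion hs hb)) c hc d hd _ hab q hq
  have hφE : ∀ s ∈ E, ∀ v ∈ s, φ v ∈ φ '' ⋃ s ∈ E, (s : Set (Amb G)) := fun s hs v hv =>
    mem_image_of_mem _ (mem_biUnion hs hv)
  have hR₂V : ∀ s ∈ R₂, ∀ v ∈ s, 𝒢₂.proj v ∈ 𝒢₂.proj '' ⋃ s ∈ R₂, (s : Set (Amb G)) :=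
    fun s hs v hv => mem_image_of_mem _ (mem_biUnion hs hv)
  constructor
  · intro s hs u hu v hv w hw t ht
    obtain ⟨s, hsR, g, rfl⟩ := hR₁G s hs
    obtain ⟨u, hu₀, rfl⟩ := 𝒢₁.exists_ρ_eq_of_mem_convexHull_image g hu
    rw [Finset.mem_image] at hv hw
    obtain ⟨v, hv, rfl⟩ := hv
    obtain ⟨w, hw, rfl⟩ := hw
    have hsK := hR₁K hsR
    have hsE : s ∈ E := Or.inl hsR
    rw [hφ _ _ (𝒢₁.vertex_mem_space hsK hv), hφ _ _ (𝒢₁.vertex_mem_space hsK hw)] at ht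
    have ht' := smul_mem_seg hiso₂ g⁻¹ ht
    rw [inv_smul_smul, inv_smul_smul] at ht'
    have := hrect g s hsE u hu₀ _ (Or.inl (hφE s hsE v hv)) _ (Or.inl (hφE s hsE w hw)) _ ht'
    rwa [smul_inv_smul, ← 𝒢₁.proj_equivariant g u (𝒢₁.mem_space hsK hu₀)] at this
  · intro s hs u hu v hv w hw x hx
    obtain ⟨s, hsR, g, rfl⟩ := hR₂G s hs
    obtain ⟨u, hu₀, rfl⟩ := 𝒢₂.exists_ρ_eq_of_mem_convexHull_image g hu
    rw [Finset.mem_image] at hv hw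
    obtain ⟨v, hv, rfl⟩ := hv
    obtain ⟨w, hw, rfl⟩ := hw
    have hsK := hR₂K hsR
    rw [hψ _ _ (𝒢₂.vertex_mem_space hsK hv), hψ _ _ (𝒢₂.vertex_mem_space hsK hw)] at hx
    have hx' := smul_mem_seg hiso₁ g⁻¹ hx
    rw [inv_smul_smul, inv_smul_smul] at hx'
    obtain ⟨s', hs', u', hu', hu'x⟩ := hC _ _ _ hx'
    have hs'E : s' ∈ E :=
      Or.inr (mem_biUnion hsR (mem_biUnion hv (mem_biUnion hw hs')))
    have hs'K := hEK hs'E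
    obtain ⟨v', hv'⟩ := 𝒢₁.K.nonempty_of_mem_faces hs'K
    have hproj : 𝒢₁.proj (𝒢₁.ρ g u') = x := by
      rw [𝒢₁.proj_equivariant g u' (𝒢₁.mem_space hs'K hu'), hu'x, smul_inv_smul]
    refine ⟨_, 𝒢₁.mapsFaces g s' hs'K, _, 𝒢₁.ρ_mem_convexHull_image g hu', hproj,
      𝒢₁.ρ g v', Finset.mem_image_of_mem _ hv', fun t ht => ?_⟩
    rw [hφ _ _ (𝒢₁.vertex_mem_space hs'K hv'),
      𝒢₂.proj_equivariant g u (𝒢₂.mem_space hsK hu₀)] at ht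
    have ht' := smul_mem_seg hiso₂ g⁻¹ ht
    rw [inv_smul_smul, inv_smul_smul] at ht'
    obtain ⟨a, ha, b, hb, hab⟩ := 𝒢₂.exists_proj_mem_seg hsK hu₀
    have hrect' := hrect g s' hs'E u' hu'
    rw [hu'x, smul_inv_smul] at hrect'
    rw [← smul_inv_smul g t]
    rcases hT₂.seg_subset_union _ (𝒢₂.proj a) _ ht' with h | h
    · exact hrect' _ (Or.inl (hφE s' hs'E v' hv')) _ (Or.inr (hR₂V s hsR a ha)) _ h
    · exact hrect' _ (Or.inr (hR₂V s hsR a ha)) _ (Or.inr (hR₂V s hsR b hb)) _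
        (seg_subset_seg_left hab h)

end Core

/-- Theorem 8.1: for two geometric actions of a finitely generated
group on `ℝ`-trees, there is a finite union of compact rectangles `D` such that the core
is contained in the closure of `G · D`. -/
theorem weak_fundamental_domain_of_geometric
    {G T₁ T₂ : Type*} [Group G] [Group.FG G] [MetricSpace T₁] [MetricSpace T₂]
    [MulAction G T₁] [MulAction G T₂]
    (hT₁ : IsRTree T₁) (hT₂ : IsRTree T₂)
    (hiso₁ : IsometricAction G T₁) (hiso₂ : IsometricAction G T₂)
    (hg₁ : GeometricAction G T₁) (hg₂ : GeometricAction G T₂) :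
    ∃ (n : ℕ) (a b : Fin n → T₁) (c d : Fin n → T₂),
      Core G T₁ T₂ ⊆
        closure (⋃ (g : G) (i : Fin n),
          (fun z => g • z) '' (seg (a i) (b i) ×ˢ seg (c i) (d i))) := by
  obtain ⟨𝒢₁⟩ := hg₁
  obtain ⟨𝒢₂⟩ := hg₂
  obtain ⟨s₁, hs₁⟩ := 𝒢₁.nonempty
  obtain ⟨s₂, hs₂⟩ := 𝒢₂.nonempty
  obtain ⟨v₁, -⟩ := 𝒢₁.K.nonempty_of_mem_faces hs₁
  obtain ⟨v₂, -⟩ := 𝒢₂.K.nonempty_of_mem_faces hs₂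
  obtain ⟨φ, hφ⟩ := 𝒢₁.exists_equivariant (𝒢₂.proj v₂)
  obtain ⟨ψ, hψ⟩ := 𝒢₂.exists_equivariant (𝒢₁.proj v₁)
  obtain ⟨A, B, hA, hB, hAB⟩ :=
    exists_finite_rectangles hT₁ hT₂ hiso₁ hiso₂ 𝒢₁ 𝒢₂ hφ hψ
  obtain ⟨n, f, -, hf⟩ := ((hA.prod hA).prod (hB.prod hB)).fin_param
  refine ⟨n, fun i => (f i).1.1, fun i => (f i).1.2, fun i => (f i).2.1, fun i => (f i).2.2, ?_⟩
  refine (hAB _ ?_).elim (core_subset_closure hT₁ hT₂ 𝒢₁ 𝒢₂ hψ)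
  intro g a ha b hb c hc d hd p hp q hq
  obtain ⟨i, hi⟩ : ((a, b), (c, d)) ∈ range f := by
    rw [hf]
    exact ⟨⟨ha, hb⟩, hc, hd⟩
  refine mem_iUnion₂.2 ⟨g, i, (p, q), ?_, rfl⟩
  simp only [hi]
  exact ⟨hp, hq⟩

end Guirardel
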